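/- Let L > 0 and let u be a C¹ ℝ^k-valued function on [0,2L] × ℝ that is 2π-periodic in its second variable θ. If e^{L/2} ‖u‖₁,₂ ≤ ‖u‖₁,₁, then (e^{L/2} − 1) ‖u‖₁,₂ ≤ (L + 1) (∫_0^{2L} ∫_0^{2π} (|∂_t u|² + |∂_θ u|²) dθ dt)^{1/2}. -/

import Mathlib

open Real MeasureTheory

variable {E : Type*} [NormedAddCommGroup E] [NormedSpace ℝ E]

/-- Partial derivative `∂_t u`. -/
noncomputable def pt (u : ℝ × ℝ → E) (p : ℝ × ℝ) : E := fderiv ℝ u p (1, 0)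

/-- Partial derivative `∂_θ u`. -/
noncomputable def pθ (u : ℝ × ℝ → E) (p : ℝ × ℝ) : E := fderiv ℝ u p (0, 1)

/-- Squared `W^{1,2}`-norm of `u` over the cylinder piece `[(i-1)L, iL] × [0, 2π]`. -/
noncomputable def normOneSq (L : ℝ) (i : ℕ) (u : ℝ × ℝ → E) : ℝ :=
  ∫ t in (((i : ℝ) - 1) * L)..((i : ℝ) * L), ∫ θ in (0 : ℝ)..(2 * π),
    ‖u (t, θ)‖ ^ 2 + ‖pt u (t, θ)‖ ^ 2 + ‖pθ u (t, θ)‖ ^ 2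

/-- The `W^{1,2}`-norm `‖u‖₁,ᵢ`. -/
noncomputable def normOne (L : ℝ) (i : ℕ) (u : ℝ × ℝ → E) : ℝ :=
  Real.sqrt (normOneSq L i u)

open Set Filter Topology

lemma le_add_sq_of_forall_weight {a x y : ℝ} (hx : 0 ≤ x) (hy : 0 ≤ y)
    (h : ∀ ε : ℝ, 0 < ε → a ≤ (1 + ε) * x ^ 2 + (1 + ε⁻¹) * y ^ 2) : a ≤ (x + y) ^ 2 := by
  have key : ∀ δ : ℝ, 0 < δ → a ≤ (x + y + 2 * δ) ^ 2 := by
    intro δ hδ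
    have hx' : 0 < x + δ := by linarith
    have hy' : 0 < y + δ := by linarith
    have h1 := h ((y + δ) / (x + δ)) (by positivity)
    have h2 : (1 + (y + δ) / (x + δ)) * x ^ 2 ≤ (1 + (y + δ) / (x + δ)) * (x + δ) ^ 2 := by
      gcongr; linarith
    have h3 : (1 + ((y + δ) / (x + δ))⁻¹) * y ^ 2
        ≤ (1 + ((y + δ) / (x + δ))⁻¹) * (y + δ) ^ 2 := by
      gcongr; linarith
    have h4 : (1 + (y + δ) / (x + δ)) * (x + δ) ^ 2 + (1 + ((y + δ) / (x + δ))⁻¹) * (y + δ) ^ 2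
        = (x + y + 2 * δ) ^ 2 := by
      field_simp
      ring
    linarith
  have hlim : Tendsto (fun δ : ℝ => (x + y + 2 * δ) ^ 2) (𝓝[>] 0) (𝓝 ((x + y) ^ 2)) := by
    have : Continuous fun δ : ℝ => (x + y + 2 * δ) ^ 2 := by fun_prop
    simpa using (this.tendsto 0).mono_left nhdsWithin_le_nhds
  exact ge_of_tendsto hlim (eventually_mem_nhdsWithin.mono key)

lemma sq_intervalIntegral_le {a b : ℝ} (hab : a < b) {f : ℝ → ℝ} (hf : Continuous f) :
    (∫ s in a..b, f s) ^ 2 ≤ (b - a) * ∫ s in a..b, f s ^ 2 := by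
  have hba : 0 < b - a := sub_pos.2 hab
  set I := ∫ s in a..b, f s with hI
  have h0 : 0 ≤ ∫ s in a..b, ((b - a) * f s - I) ^ 2 :=
    intervalIntegral.integral_nonneg hab.le fun _ _ => sq_nonneg _
  have h1 : ∫ s in a..b, ((b - a) * f s - I) ^ 2
      = (b - a) * ((b - a) * (∫ s in a..b, f s ^ 2) - I ^ 2) := by
    have : ∀ s, ((b - a) * f s - I) ^ 2
        = (b - a) ^ 2 * f s ^ 2 - 2 * (b - a) * I * f s + I ^ 2 := fun s => by ring
    simp_rw [this]
    rw [intervalIntegral.integral_add, intervalIntegral.integral_sub,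
      intervalIntegral.integral_const_mul, intervalIntegral.integral_const_mul,
      intervalIntegral.integral_const, ← hI, smul_eq_mul]
    · ring
    all_goals exact Continuous.intervalIntegrable (by fun_prop) _ _
  rw [h1] at h0
  linarith [nonneg_of_mul_nonneg_right h0 hba]

lemma norm_sub_sq_le_mul_integral_deriv [CompleteSpace E] {a b : ℝ} (hab : a < b) {f f' : ℝ → E}
    (hf : Continuous f) (hf' : Continuous f') (hd : ∀ s ∈ Ioo a b, HasDerivAt f (f' s) s) :
    ‖f b - f a‖ ^ 2 ≤ (b - a) * ∫ s in a..b, ‖f' s‖ ^ 2 := by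
  rw [← intervalIntegral.integral_eq_sub_of_hasDerivAt_of_le hab.le hf.continuousOn hd
    (hf'.intervalIntegrable _ _)]
  calc ‖∫ s in a..b, f' s‖ ^ 2 ≤ (∫ s in a..b, ‖f' s‖) ^ 2 := by
        gcongr
        exact intervalIntegral.norm_integral_le_integral_norm hab.le
    _ ≤ _ := sq_intervalIntegral_le hab hf'.norm

lemma norm_sq_le_weighted {F : Type*} [SeminormedAddCommGroup F] (v w : F) {ε : ℝ}
    (hε : 0 < ε) :
    ‖v‖ ^ 2 ≤ (1 + ε) * ‖w‖ ^ 2 + (1 + ε⁻¹) * ‖w - v‖ ^ 2 := by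
  have h : ‖v‖ ≤ ‖w‖ + ‖w - v‖ := by
    calc ‖v‖ = ‖w - (w - v)‖ := by congr 1; abel
      _ ≤ _ := norm_sub_le _ _
  have h2 : ‖v‖ ^ 2 ≤ (‖w‖ + ‖w - v‖) ^ 2 := by gcongr
  have h3 : (1 + ε) * ‖w‖ ^ 2 + (1 + ε⁻¹) * ‖w - v‖ ^ 2 - (‖w‖ + ‖w - v‖) ^ 2
      = ε⁻¹ * (ε * ‖w‖ - ‖w - v‖) ^ 2 := by
    field_simp
    ring
  have h4 : 0 ≤ ε⁻¹ * (ε * ‖w‖ - ‖w - v‖) ^ 2 := by positivity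
  linarith

lemma continuous_slice_integral {f : ℝ → ℝ → ℝ} (hf : Continuous (Function.uncurry f)) (a b : ℝ) :
    Continuous fun t => ∫ θ in a..b, f t θ :=
  intervalIntegral.continuous_parametric_intervalIntegral_of_continuous' hf a b

/-- Minkowski's inequality for the `L²` norms of `U` on two adjacent cylinder pieces. -/
lemma integral_sq_le_of_translate [CompleteSpace E] {L c : ℝ} (hL : 0 < L) (hc : 0 ≤ c)
    {U V : ℝ → ℝ → E}
    (hU : Continuous (Function.uncurry U)) (hV : Continuous (Function.uncurry V))
    (hd : ∀ θ, ∀ t ∈ Ioo 0 (2 * L), HasDerivAt (fun s => U s θ) (V t θ) t) :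
    ∫ t in (0 : ℝ)..L, ∫ θ in (0 : ℝ)..c, ‖U t θ‖ ^ 2 ≤
      (√(∫ t in L..(2 * L), ∫ θ in (0 : ℝ)..c, ‖U t θ‖ ^ 2) +
        L * √(∫ t in (0 : ℝ)..(2 * L), ∫ θ in (0 : ℝ)..c, ‖V t θ‖ ^ 2)) ^ 2 := by
  have hU2 : Continuous (Function.uncurry fun t θ => ‖U t θ‖ ^ 2) := hU.norm.pow 2
  have hV2 : Continuous (Function.uncurry fun t θ => ‖V t θ‖ ^ 2) := hV.norm.pow 2
  have hUs : Continuous (Function.uncurry fun t θ => ‖U (t + L) θ‖ ^ 2) :=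
    hU2.comp (f := fun p : ℝ × ℝ => (p.1 + L, p.2)) (by fun_prop)
  have hVs : Continuous (Function.uncurry fun θ t => ‖V t θ‖ ^ 2) := hV2.comp continuous_swap
  set Y := ∫ t in (0 : ℝ)..(2 * L), ∫ θ in (0 : ℝ)..c, ‖V t θ‖ ^ 2 with hY
  have hY0 : 0 ≤ Y := intervalIntegral.integral_nonneg (by linarith) fun _ _ =>
    intervalIntegral.integral_nonneg hc fun _ _ => by positivity
  have hX0 : 0 ≤ ∫ t in L..(2 * L), ∫ θ in (0 : ℝ)..c, ‖U t θ‖ ^ 2 :=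
    intervalIntegral.integral_nonneg (by linarith) fun _ _ =>
    intervalIntegral.integral_nonneg hc fun _ _ => by positivity
  have hswap : ∫ θ in (0 : ℝ)..c, ∫ s in (0 : ℝ)..(2 * L), ‖V s θ‖ ^ 2 = Y := by
    rw [hY]
    refine intervalIntegral_intervalIntegral_swap ?_
    exact (hVs.continuousOn.integrableOn_compact
      (isCompact_uIcc.prod isCompact_uIcc)).mono_set
      (prod_mono uIoc_subset_uIcc uIoc_subset_uIcc)
  have hshift : ∫ t in L..(2 * L), ∫ θ in (0 : ℝ)..c, ‖U t θ‖ ^ 2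
      = ∫ t in (0 : ℝ)..L, ∫ θ in (0 : ℝ)..c, ‖U (t + L) θ‖ ^ 2 := by
    rw [intervalIntegral.integral_comp_add_right (fun t => ∫ θ in (0 : ℝ)..c, ‖U t θ‖ ^ 2)]
    congr 1 <;> ring
  have hpt : ∀ t ∈ Icc 0 L, ∀ θ, ‖U (t + L) θ - U t θ‖ ^ 2
      ≤ L * ∫ s in (0 : ℝ)..(2 * L), ‖V s θ‖ ^ 2 := by
    intro t ht θ
    have hUθ : Continuous fun s => U s θ := hU.comp (f := fun s : ℝ => (s, θ)) (by fun_prop)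
    have hVθ : Continuous fun s => V s θ := hV.comp (f := fun s : ℝ => (s, θ)) (by fun_prop)
    have h := norm_sub_sq_le_mul_integral_deriv (a := t) (b := t + L) (by linarith) hUθ hVθ
      fun s hs => hd θ s ⟨by linarith [ht.1, hs.1], by linarith [ht.2, hs.2]⟩
    refine h.trans ?_
    rw [add_sub_cancel_left]
    gcongr
    refine intervalIntegral.integral_mono_interval ht.1 (by linarith) (by linarith [ht.2])
      (Eventually.of_forall fun s => by positivity) ((hVθ.norm.pow 2).intervalIntegrable _ _)
  refine le_add_sq_of_forall_weight (sqrt_nonneg _) (by positivity) fun ε hε => ?_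
  rw [sq_sqrt hX0, mul_pow, sq_sqrt hY0, hshift]
  have hin : ∀ t ∈ Icc 0 L, ∫ θ in (0 : ℝ)..c, ‖U t θ‖ ^ 2 ≤
      (1 + ε) * (∫ θ in (0 : ℝ)..c, ‖U (t + L) θ‖ ^ 2) + (1 + ε⁻¹) * (L * Y) := by
    intro t ht
    have e1 : Continuous fun θ => ‖U t θ‖ ^ 2 := hU2.comp (f := fun θ : ℝ => (t, θ)) (by fun_prop)
    have e2 : Continuous fun θ => ‖U (t + L) θ‖ ^ 2 :=
      hU2.comp (f := fun θ : ℝ => (t + L, θ)) (by fun_prop)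
    have e3 := continuous_slice_integral hVs 0 (2 * L)
    rw [← hswap, ← intervalIntegral.integral_const_mul, ← intervalIntegral.integral_const_mul,
      ← intervalIntegral.integral_const_mul, ← intervalIntegral.integral_add
        (Continuous.intervalIntegrable (by fun_prop) _ _)
        (Continuous.intervalIntegrable (by fun_prop) _ _)]
    refine intervalIntegral.integral_mono_on hc (e1.intervalIntegrable _ _)
      (Continuous.intervalIntegrable (by fun_prop) _ _) fun θ _ => ?_
    refine (norm_sq_le_weighted (U t θ) (U (t + L) θ) hε).trans ?_
    gcongr
    exact hpt t ht θ
  have c1 := continuous_slice_integral hU2 0 c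
  have c2 := continuous_slice_integral hUs 0 c
  refine (intervalIntegral.integral_mono_on hL.le (c1.intervalIntegrable _ _)
    (Continuous.intervalIntegrable (by fun_prop) _ _) hin).trans_eq ?_
  rw [intervalIntegral.integral_add (Continuous.intervalIntegrable (by fun_prop) _ _)
    (Continuous.intervalIntegrable (by fun_prop) _ _), intervalIntegral.integral_const_mul,
    intervalIntegral.integral_const, smul_eq_mul]
  ring

lemma sqrt_add_le_of_shift {L A₁ A₂ G₁ G₂ : ℝ} (hL : 0 < L) (hG₁ : 0 ≤ G₁)
    (hG₂ : 0 ≤ G₂) (h : A₁ ≤ (√A₂ + L * √(G₁ + G₂)) ^ 2) :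
    √(A₁ + G₁) ≤ √(A₂ + G₂) + (L + 1) * √(G₁ + G₂) := by
  have hG : √(G₁ + G₂) ^ 2 = G₁ + G₂ := sq_sqrt (by positivity)
  have hmono : √A₂ ≤ √(A₂ + G₂) := sqrt_le_sqrt (by linarith)
  have ha := sqrt_nonneg A₂
  have hg := sqrt_nonneg (G₁ + G₂)
  refine sqrt_le_iff.2 ⟨by positivity, ?_⟩
  have h1 : (√A₂ + (L + 1) * √(G₁ + G₂)) ^ 2 ≤ (√(A₂ + G₂) + (L + 1) * √(G₁ + G₂)) ^ 2 := by
    gcongr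
  have h2 : 0 ≤ (√A₂ + L * √(G₁ + G₂)) * √(G₁ + G₂) := by positivity
  nlinarith

/-- A `C¹` function on a closed strip has continuous extensions of its values and partial
derivatives to the whole plane. -/
lemma exists_continuous_extensions {T : ℝ} (hT : 0 < T) {u : ℝ × ℝ → E}
    (hu : ContDiffOn ℝ 1 u (Icc 0 T ×ˢ univ)) :
    ∃ U V W : ℝ → ℝ → E, Continuous (Function.uncurry U) ∧ Continuous (Function.uncurry V) ∧
      Continuous (Function.uncurry W) ∧
      (∀ t ∈ Ioo 0 T, ∀ θ, u (t, θ) = U t θ ∧ pt u (t, θ) = V t θ ∧ pθ u (t, θ) = W t θ) ∧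
      ∀ θ, ∀ t ∈ Ioo 0 T, HasDerivAt (fun s => U s θ) (V t θ) t := by
  set S : Set (ℝ × ℝ) := Icc 0 T ×ˢ univ with hS
  have hSu : UniqueDiffOn ℝ S := (uniqueDiffOn_Icc hT).prod uniqueDiffOn_univ
  have hD := hu.continuousOn_fderivWithin hSu le_rfl
  set P : ℝ × ℝ → ℝ × ℝ := fun p => ((projIcc 0 T hT.le p.1 : ℝ), p.2)
  have hP : Continuous P := by
    have := continuous_projIcc (h := hT.le)
    fun_prop
  have hPS : ∀ p, P p ∈ S := fun p => ⟨(projIcc 0 T hT.le p.1).2, mem_univ _⟩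
  have hPeq : ∀ t ∈ Ioo 0 T, ∀ θ, P (t, θ) = (t, θ) := fun t ht θ => by
    simp [P, projIcc_of_mem hT.le (Ioo_subset_Icc_self ht)]
  have hDP := hD.comp_continuous hP hPS
  have hnhds : ∀ t ∈ Ioo 0 T, ∀ θ, S ∈ 𝓝 (t, θ) := fun t ht θ =>
    prod_mem_nhds (Icc_mem_nhds ht.1 ht.2) univ_mem
  refine ⟨fun t θ => u (P (t, θ)), fun t θ => fderivWithin ℝ u S (P (t, θ)) (1, 0),
    fun t θ => fderivWithin ℝ u S (P (t, θ)) (0, 1), hu.continuousOn.comp_continuous hP hPS,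
    hDP.clm_apply continuous_const, hDP.clm_apply continuous_const, fun t ht θ => ?_,
    fun θ t ht => ?_⟩
  · simp only [hPeq t ht θ, pt, pθ, fderivWithin_of_mem_nhds (hnhds t ht θ), and_self]
  · simp only [hPeq t ht θ, fderivWithin_of_mem_nhds (hnhds t ht θ)]
    have hdiff : DifferentiableAt ℝ u (t, θ) :=
      (hu.contDiffAt (hnhds t ht θ)).differentiableAt one_ne_zero
    have h := hdiff.hasFDerivAt.comp_hasDerivAt t ((hasDerivAt_id t).prodMk (hasDerivAt_const t θ))
    refine h.congr_of_eventuallyEq ?_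
    filter_upwards [Ioo_mem_nhds ht.1 ht.2] with s hs
    simp [hPeq s hs θ]

/-- Let `u` be a `C¹` `ℝ^k`-valued function on `[0,2L] × ℝ`, `2π`-periodic in `θ`.  If
`e^{L/2} ‖u‖₁,₂ ≤ ‖u‖₁,₁` then
`(e^{L/2} − 1) ‖u‖₁,₂ ≤ (L + 1) (∫_0^{2L} ∫_0^{2π} (|∂_t u|² + |∂_θ u|²) dθ dt)^{1/2}`. -/
theorem gradient_controls_middle_norm (L : ℝ) (hL : 0 < L) (k : ℕ)
    (u : ℝ × ℝ → EuclideanSpace ℝ (Fin k))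
    (hreg : ContDiffOn ℝ 1 u ((Set.Icc (0 : ℝ) (2 * L)) ×ˢ (Set.univ : Set ℝ)))
    (hper : ∀ t θ : ℝ, u (t, θ + 2 * π) = u (t, θ))
    (hyp : Real.exp (L / 2) * normOne L 2 u ≤ normOne L 1 u) :
    (Real.exp (L / 2) - 1) * normOne L 2 u ≤
      (L + 1) * Real.sqrt (∫ t in (0 : ℝ)..(2 * L), ∫ θ in (0 : ℝ)..(2 * π),
        ‖pt u (t, θ)‖ ^ 2 + ‖pθ u (t, θ)‖ ^ 2) := by
  obtain ⟨U, V, W, hU, hV, hW, heq, hd⟩ := exists_continuous_extensions (by positivity) hreg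
  have hpi : (0 : ℝ) ≤ 2 * π := by positivity
  have hU2 : Continuous (Function.uncurry fun t θ => ‖U t θ‖ ^ 2) := hU.norm.pow 2
  have hV2 : Continuous (Function.uncurry fun t θ => ‖V t θ‖ ^ 2) := hV.norm.pow 2
  have hVW : Continuous (Function.uncurry fun t θ => ‖V t θ‖ ^ 2 + ‖W t θ‖ ^ 2) :=
    hV2.add (hW.norm.pow 2)
  set a : ℝ → ℝ := fun t => ∫ θ in (0 : ℝ)..(2 * π), ‖U t θ‖ ^ 2 with ha
  set g : ℝ → ℝ := fun t => ∫ θ in (0 : ℝ)..(2 * π), (‖V t θ‖ ^ 2 + ‖W t θ‖ ^ 2) with hg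
  have hac : Continuous a := continuous_slice_integral hU2 _ _
  have hgc : Continuous g := continuous_slice_integral hVW _ _
  have hg0 : ∀ t, 0 ≤ g t := fun t =>
    intervalIntegral.integral_nonneg hpi fun _ _ => by positivity
  have hnorm : ∀ b c : ℝ, 0 ≤ b → b ≤ c → c ≤ 2 * L →
      (∫ t in b..c, ∫ θ in (0 : ℝ)..(2 * π),
        ‖u (t, θ)‖ ^ 2 + ‖pt u (t, θ)‖ ^ 2 + ‖pθ u (t, θ)‖ ^ 2)
      = (∫ t in b..c, a t) + ∫ t in b..c, g t := by
    intro b c hb hbc hc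
    rw [← intervalIntegral.integral_add (hac.intervalIntegrable _ _) (hgc.intervalIntegrable _ _)]
    refine intervalIntegral.integral_congr_Ioo_of_le hbc fun t ht => ?_
    have ht' : t ∈ Ioo 0 (2 * L) := ⟨hb.trans_lt ht.1, ht.2.trans_le hc⟩
    have hUt : Continuous fun θ => ‖U t θ‖ ^ 2 :=
      hU2.comp (f := fun θ : ℝ => (t, θ)) (by fun_prop)
    have hVWt : Continuous fun θ => ‖V t θ‖ ^ 2 + ‖W t θ‖ ^ 2 :=
      hVW.comp (f := fun θ : ℝ => (t, θ)) (by fun_prop)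
    simp only [ha, hg]
    rw [← intervalIntegral.integral_add (hUt.intervalIntegrable _ _)
      (hVWt.intervalIntegrable _ _)]
    refine intervalIntegral.integral_congr fun θ _ => ?_
    obtain ⟨h1, h2, h3⟩ := heq t ht' θ
    simp only [h1, h2, h3, add_assoc]
  have hgrad : (∫ t in (0 : ℝ)..(2 * L), ∫ θ in (0 : ℝ)..(2 * π),
      ‖pt u (t, θ)‖ ^ 2 + ‖pθ u (t, θ)‖ ^ 2)
      = (∫ t in (0 : ℝ)..L, g t) + ∫ t in L..(2 * L), g t := by
    rw [intervalIntegral.integral_add_adjacent_intervals (hgc.intervalIntegrable _ _)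
      (hgc.intervalIntegrable _ _)]
    refine intervalIntegral.integral_congr_Ioo_of_le (by linarith) fun t ht => ?_
    refine intervalIntegral.integral_congr fun θ _ => ?_
    obtain ⟨-, h2, h3⟩ := heq t ht θ
    simp only [h2, h3]
  have hn1 : normOne L 1 u = √((∫ t in (0 : ℝ)..L, a t) + ∫ t in (0 : ℝ)..L, g t) := by
    rw [normOne, normOneSq, ← hnorm 0 L le_rfl hL.le (by linarith)]
    norm_num
  have hn2 : normOne L 2 u = √((∫ t in L..(2 * L), a t) + ∫ t in L..(2 * L), g t) := by
    rw [normOne, normOneSq, ← hnorm L (2 * L) hL.le (by linarith) le_rfl]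
    norm_num
  have hVg : ∫ t in (0 : ℝ)..(2 * L), ∫ θ in (0 : ℝ)..(2 * π), ‖V t θ‖ ^ 2
      ≤ (∫ t in (0 : ℝ)..L, g t) + ∫ t in L..(2 * L), g t := by
    rw [intervalIntegral.integral_add_adjacent_intervals (hgc.intervalIntegrable _ _)
      (hgc.intervalIntegrable _ _)]
    refine intervalIntegral.integral_mono_on (by linarith)
      ((continuous_slice_integral hV2 _ _).intervalIntegrable _ _)
      (hgc.intervalIntegrable _ _) fun t _ => ?_
    refine intervalIntegral.integral_mono_on hpi
      ((hV2.comp (f := fun θ : ℝ => (t, θ)) (by fun_prop)).intervalIntegrable _ _)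
      ((hVW.comp (f := fun θ : ℝ => (t, θ)) (by fun_prop)).intervalIntegrable _ _)
      fun θ _ => ?_
    simp
  have hmink : ∫ t in (0 : ℝ)..L, a t ≤ (√(∫ t in L..(2 * L), a t) +
      L * √((∫ t in (0 : ℝ)..L, g t) + ∫ t in L..(2 * L), g t)) ^ 2 := by
    refine (integral_sq_le_of_translate hL hpi hU hV hd).trans ?_
    gcongr
  have hfinal := sqrt_add_le_of_shift hL
    (intervalIntegral.integral_nonneg hL.le fun t _ => hg0 t)
    (intervalIntegral.integral_nonneg (by linarith) fun t _ => hg0 t) hmink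
  rw [hgrad]
  rw [← hn1, ← hn2] at hfinal
  linarith
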